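/- arXiv:2511.07504 — 6 statements merged into one kernel-verified Lean document; each statement's English description precedes it below -/
import Mathlib

section
/- Let W ∈ ℝ^{d×d} be symmetric positive definite, c ∈ ℝ^d, and let 𝒳 ⊆ ℝ^d with 0 ∉ 𝒳. Set Θ = {θ ∈ ℝ^d : ‖θ − c‖_W ≤ 1}. Then x* ∈ 𝒳 maximizes the function x ↦ xᵀc + ‖x‖_{W⁻¹} over 𝒳 if and only if the pair (x*, θ*) with θ* = c + W⁻¹x*/‖x*‖_{W⁻¹} maximizes the bilinear function (x, θ) ↦ xᵀθ over 𝒳 × Θ. -/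
open Matrix Set

/-- `mNorm M z = √(zᵀ M z)`. -/
noncomputable def mNorm {d : ℕ} (M : Matrix (Fin d) (Fin d) ℝ) (z : Fin d → ℝ) : ℝ :=
  Real.sqrt (z ⬝ᵥ M *ᵥ z)

theorem Matrix.PosDef.mulVec_inv_mulVec {d : ℕ} {W : Matrix (Fin d) (Fin d) ℝ} (hW : W.PosDef)
    (x : Fin d → ℝ) : W *ᵥ (W⁻¹ *ᵥ x) = x := by
  rw [mulVec_mulVec, mul_nonsing_inv _ ((isUnit_iff_isUnit_det W).mp hW.isUnit), one_mulVec]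

theorem mNorm_sq {d : ℕ} {M : Matrix (Fin d) (Fin d) ℝ} (hM : M.PosSemidef) (z : Fin d → ℝ) :
    mNorm M z ^ 2 = z ⬝ᵥ M *ᵥ z :=
  Real.sq_sqrt (by simpa using hM.dotProduct_mulVec_nonneg z)

theorem mNorm_pos {d : ℕ} {M : Matrix (Fin d) (Fin d) ℝ} (hM : M.PosDef) {z : Fin d → ℝ}
    (hz : z ≠ 0) : 0 < mNorm M z :=
  Real.sqrt_pos.mpr (by simpa using hM.dotProduct_mulVec_pos hz)

/-- The generalized Cauchy–Schwarz inequality for the dual norms of `W` and `W⁻¹`. -/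
theorem dotProduct_le_mNorm_inv_mul_mNorm {d : ℕ} {W : Matrix (Fin d) (Fin d) ℝ} (hW : W.PosDef)
    (x u : Fin d → ℝ) : x ⬝ᵥ u ≤ mNorm W⁻¹ x * mNorm W u := by
  have hsymm : (W⁻¹ *ᵥ x) ⬝ᵥ (W *ᵥ u) = x ⬝ᵥ u := by
    have hT : Wᵀ = W := by simpa using hW.isHermitian.eq
    rw [dotProduct_mulVec, ← mulVec_transpose, hT, hW.mulVec_inv_mulVec]
  have hquad (t : ℝ) :
      0 ≤ (x ⬝ᵥ W⁻¹ *ᵥ x) * (t * t) + (-2 * (x ⬝ᵥ u)) * t + u ⬝ᵥ W *ᵥ u := by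
    have h : 0 ≤ (u - t • (W⁻¹ *ᵥ x)) ⬝ᵥ W *ᵥ (u - t • (W⁻¹ *ᵥ x)) := by
      simpa using hW.posSemidef.dotProduct_mulVec_nonneg (u - t • (W⁻¹ *ᵥ x))
    rw [mulVec_sub, mulVec_smul, hW.mulVec_inv_mulVec] at h
    simp only [sub_dotProduct, dotProduct_sub, smul_dotProduct, dotProduct_smul, smul_eq_mul,
      hsymm, dotProduct_comm u x, dotProduct_comm (W⁻¹ *ᵥ x) x] at h
    linarith
  have hdisc := discrim_le_zero hquad
  rw [discrim, ← mNorm_sq hW.posSemidef.inv, ← mNorm_sq hW.posSemidef] at hdisc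
  exact le_of_abs_le (abs_le_of_sq_le_sq (by linarith)
    (mul_nonneg (Real.sqrt_nonneg _) (Real.sqrt_nonneg _)))

theorem dotProduct_add_inv_mNorm_smul {d : ℕ} {W : Matrix (Fin d) (Fin d) ℝ} (hW : W.PosDef)
    (c : Fin d → ℝ) {x : Fin d → ℝ} (hx : x ≠ 0) :
    x ⬝ᵥ (c + (mNorm W⁻¹ x)⁻¹ • (W⁻¹ *ᵥ x)) = x ⬝ᵥ c + mNorm W⁻¹ x := by
  have hne := (mNorm_pos hW.inv hx).ne'
  rw [dotProduct_add, dotProduct_smul, ← mNorm_sq hW.posSemidef.inv, smul_eq_mul]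
  field_simp

theorem mNorm_inv_mNorm_smul {d : ℕ} {W : Matrix (Fin d) (Fin d) ℝ} (hW : W.PosDef)
    {x : Fin d → ℝ} (hx : x ≠ 0) : mNorm W ((mNorm W⁻¹ x)⁻¹ • (W⁻¹ *ᵥ x)) = 1 := by
  have hne := (mNorm_pos hW.inv hx).ne'
  rw [mNorm, Real.sqrt_eq_one, mulVec_smul, hW.mulVec_inv_mulVec, smul_dotProduct,
    dotProduct_smul, dotProduct_comm, ← mNorm_sq hW.posSemidef.inv, smul_eq_mul, smul_eq_mul]
  field_simp

/-- with `Θ = {θ : ‖θ - c‖_W ≤ 1}`, a point `x* ∈ 𝒳` (with `0 ∉ 𝒳`)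
maximizes `x ↦ xᵀc + ‖x‖_{W⁻¹}` over `𝒳` iff the pair `(x*, θ*)`, where
`θ* = c + W⁻¹x*/‖x*‖_{W⁻¹}`, maximizes `(x,θ) ↦ xᵀθ` over `𝒳 × Θ`. -/
theorem stmt1 {d : ℕ} (W : Matrix (Fin d) (Fin d) ℝ) (hW : W.PosDef)
    (c : Fin d → ℝ) (X : Set (Fin d → ℝ)) (h0 : (0 : Fin d → ℝ) ∉ X)
    (xs : Fin d → ℝ) (hxs : xs ∈ X) :
    (∀ x ∈ X, x ⬝ᵥ c + mNorm W⁻¹ x ≤ xs ⬝ᵥ c + mNorm W⁻¹ xs) ↔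
      ((c + (mNorm W⁻¹ xs)⁻¹ • (W⁻¹ *ᵥ xs)) ∈ {θ : Fin d → ℝ | mNorm W (θ - c) ≤ 1} ∧
        ∀ x ∈ X, ∀ θ ∈ {θ : Fin d → ℝ | mNorm W (θ - c) ≤ 1},
          x ⬝ᵥ θ ≤ xs ⬝ᵥ (c + (mNorm W⁻¹ xs)⁻¹ • (W⁻¹ *ᵥ xs))) := by
  have hne {x : Fin d → ℝ} (hx : x ∈ X) : x ≠ 0 := fun h => h0 (h ▸ hx)
  have hmem {x : Fin d → ℝ} (hx : x ∈ X) :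
      (c + (mNorm W⁻¹ x)⁻¹ • (W⁻¹ *ᵥ x)) ∈ {θ : Fin d → ℝ | mNorm W (θ - c) ≤ 1} := by
    rw [mem_ofPred_eq, add_sub_cancel_left, mNorm_inv_mNorm_smul hW (hne hx)]
  rw [dotProduct_add_inv_mNorm_smul hW c (hne hxs)]
  refine ⟨fun h => ⟨hmem hxs, fun x hx θ hθ => le_trans ?_ (h x hx)⟩, fun h x hx => ?_⟩
  · calc x ⬝ᵥ θ = x ⬝ᵥ c + x ⬝ᵥ (θ - c) := by rw [dotProduct_sub]; ring
      _ ≤ x ⬝ᵥ c + mNorm W⁻¹ x * mNorm W (θ - c) := by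
        gcongr; exact dotProduct_le_mNorm_inv_mul_mNorm hW _ _
      _ ≤ x ⬝ᵥ c + mNorm W⁻¹ x := by
        gcongr; exact mul_le_of_le_one_right (Real.sqrt_nonneg _) hθ
  · rw [← dotProduct_add_inv_mNorm_smul hW c (hne hx)]
    exact h.2 x hx _ (hmem hx)
end

section
/- Let Λ = diag(λ_1, …, λ_d) with all λ_i > 0, b ∈ ℝ^d, and ε > 0. Define b₊ ∈ ℝ^d by b₊ᵢ = sign(bᵢ)·max(|bᵢ|, ε/(2√d)). Then for every φ ∈ ℝ^d with ‖φ − b‖_Λ ≤ 1, the vector φ₊ = φ + b₊ − b satisfies ‖φ₊ − b₊‖_Λ = ‖φ − b‖_Λ ≤ 1 and ‖φ₊‖_2 ≥ ‖φ‖_2 − ε/2. Consequently, sup{‖ψ‖_2 : ‖ψ − b₊‖_Λ ≤ 1} ≥ sup{‖φ‖_2 : ‖φ − b‖_Λ ≤ 1} − ε/2, and if ψ satisfies ‖ψ − b₊‖_Λ ≤ 1 and ‖ψ‖_2 ≥ sup{‖ψ'‖_2 : ‖ψ' − b₊‖_Λ ≤ 1} − ε/2, then φ = ψ + b − b₊ satisfies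 ‖φ − b‖_Λ ≤ 1 and ‖φ‖_2 ≥ sup{‖φ'‖_2 : ‖φ' − b‖_Λ ≤ 1} − ε. -/
open Matrix Set

/-- Euclidean norm of a vector in `ℝ^d`. -/
noncomputable def e2 {d : ℕ} (z : Fin d → ℝ) : ℝ :=
  Real.sqrt (∑ i, z i ^ 2)

theorem e2_eq_norm {d : ℕ} (z : Fin d → ℝ) : e2 z = ‖WithLp.toLp 2 z‖ := by
  simp [e2, EuclideanSpace.norm_eq]

theorem e2_sub_le_e2_add {d : ℕ} (x y : Fin d → ℝ) : e2 x - e2 y ≤ e2 (x + y) := by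
  simp only [e2_eq_norm, WithLp.toLp_add]
  have h := norm_sub_norm_le (WithLp.toLp 2 x) (-WithLp.toLp 2 y)
  simpa using h

theorem e2_sub_le_e2_sub {d : ℕ} (x y : Fin d → ℝ) : e2 x - e2 y ≤ e2 (x - y) := by
  simp only [e2_eq_norm, WithLp.toLp_sub]
  exact norm_sub_norm_le _ _

theorem e2_le_e2 {d : ℕ} {x y : Fin d → ℝ} (h : ∀ i, |x i| ≤ |y i|) : e2 x ≤ e2 y :=
  Real.sqrt_le_sqrt (Finset.sum_le_sum fun i _ => sq_le_sq.2 (h i))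

theorem e2_le_of_abs_le {d : ℕ} {x : Fin d → ℝ} {c : ℝ} (hc : 0 ≤ c)
    (h : ∀ i, |x i| ≤ c / √(d : ℝ)) : e2 x ≤ c := by
  refine Real.sqrt_le_iff.2 ⟨hc, ?_⟩
  have hsum : ∑ i, x i ^ 2 ≤ ∑ _i : Fin d, (c / √(d : ℝ)) ^ 2 :=
    Finset.sum_le_sum fun i _ => sq_le_sq' (abs_le.1 (h i)).1 (abs_le.1 (h i)).2
  refine hsum.trans ?_
  rcases Nat.eq_zero_or_pos d with rfl | hd
  · simpa using sq_nonneg c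
  · have hd' : (0 : ℝ) < d := by exact_mod_cast hd
    simp only [Finset.sum_const, Finset.card_univ, Fintype.card_fin, nsmul_eq_mul, div_pow,
      Real.sq_sqrt hd'.le]
    rw [mul_div_cancel₀ _ hd'.ne']

theorem mNorm_diagonal {d : ℕ} (lam z : Fin d → ℝ) :
    mNorm (Matrix.diagonal lam) z = √(∑ i, lam i * z i ^ 2) := by
  simp only [mNorm, dotProduct, Matrix.mulVec_diagonal]
  congr 1
  exact Finset.sum_congr rfl fun i _ => by ring

theorem bddAbove_e2_ellipsoid {d : ℕ} {lam : Fin d → ℝ} (hlam : ∀ i, 0 < lam i)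
    (c : Fin d → ℝ) :
    BddAbove {r : ℝ | ∃ ψ : Fin d → ℝ, mNorm (Matrix.diagonal lam) (ψ - c) ≤ 1 ∧ r = e2 ψ} := by
  refine ⟨√(∑ i, (2 * c i ^ 2 + 2 * (1 / lam i))), ?_⟩
  rintro r ⟨ψ, hψ, rfl⟩
  refine Real.sqrt_le_sqrt (Finset.sum_le_sum fun i _ => ?_)
  rw [mNorm_diagonal, Real.sqrt_le_one] at hψ
  have h1 : lam i * (ψ - c) i ^ 2 ≤ 1 :=
    (Finset.single_le_sum (f := fun i => lam i * (ψ - c) i ^ 2)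
      (fun j _ => mul_nonneg (hlam j).le (sq_nonneg _)) (Finset.mem_univ i)).trans hψ
  have h2 : (ψ i - c i) ^ 2 ≤ 1 / lam i := by
    rw [le_div_iff₀ (hlam i), mul_comm]
    simpa using h1
  nlinarith [sq_nonneg (ψ i - 2 * c i)]

theorem sSup_e2_ellipsoid_mono {d : ℕ} {lam : Fin d → ℝ} (hlam : ∀ i, 0 < lam i)
    {b c : Fin d → ℝ} (h : ∀ i, |b i| ≤ |c i|) :
    sSup {r : ℝ | ∃ φ : Fin d → ℝ, mNorm (Matrix.diagonal lam) (φ - b) ≤ 1 ∧ r = e2 φ} ≤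
      sSup {r : ℝ | ∃ ψ : Fin d → ℝ, mNorm (Matrix.diagonal lam) (ψ - c) ≤ 1 ∧ r = e2 ψ} := by
  refine csSup_le ⟨e2 b, b, by simp [mNorm], rfl⟩ ?_
  rintro r ⟨φ, hφ, rfl⟩
  let z : Fin d → ℝ := fun i => if 0 ≤ c i then |φ i - b i| else -|φ i - b i|
  have hz : ∀ i, z i ^ 2 = (φ i - b i) ^ 2 := fun i => by
    simp only [z]; split_ifs <;> simp
  have hle : e2 φ ≤ e2 (c + z) := e2_le_e2 fun i => by
    have hφi : |φ i| ≤ |b i| + |φ i - b i| := by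
      simpa using abs_add_le (b i) (φ i - b i)
    refine (hφi.trans (add_le_add_left (h i) _)).trans ?_
    simp only [z, Pi.add_apply]
    split_ifs with hc
    · rw [abs_of_nonneg hc]; exact le_abs_self _
    · rw [abs_of_neg (not_le.1 hc)]
      refine le_trans (le_of_eq ?_) (neg_le_abs _)
      ring
  refine hle.trans (le_csSup (bddAbove_e2_ellipsoid hlam c) ⟨c + z, ?_, rfl⟩)
  rw [add_sub_cancel_left]
  rw [mNorm_diagonal] at hφ ⊢
  simpa [hz] using hφ

/-- with `Λ = diag(λ)`, `λ > 0`, `ε > 0` and the clipped center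
`b₊ᵢ = sign(bᵢ)·max(|bᵢ|, ε/(2√d))` (where `sign(a) = 1` if `a ≥ 0`, `-1` otherwise):
for every `φ` with `‖φ - b‖_Λ ≤ 1`, the vector `φ₊ = φ + b₊ - b` satisfies
`‖φ₊ - b₊‖_Λ = ‖φ - b‖_Λ ≤ 1` and `‖φ₊‖₂ ≥ ‖φ‖₂ - ε/2`; consequently the sup of
`‖·‖₂` over the shifted ellipsoid is within `ε/2` of that over the original one,
and any `ε/2`-maximizer `ψ` for the shifted ellipsoid yields `φ = ψ + b - b₊`,
an `ε`-maximizer for the original ellipsoid. -/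
theorem stmt6 {d : ℕ} (lam : Fin d → ℝ) (hlam : ∀ i, 0 < lam i)
    (b : Fin d → ℝ) (ε : ℝ) (hε : 0 < ε) (bp : Fin d → ℝ)
    (hbp : ∀ i, bp i = (if 0 ≤ b i then (1 : ℝ) else -1) *
      max |b i| (ε / (2 * Real.sqrt (d : ℝ)))) :
    (∀ φ : Fin d → ℝ, mNorm (Matrix.diagonal lam) (φ - b) ≤ 1 →
      mNorm (Matrix.diagonal lam) ((φ + bp - b) - bp) = mNorm (Matrix.diagonal lam) (φ - b) ∧
      mNorm (Matrix.diagonal lam) ((φ + bp - b) - bp) ≤ 1 ∧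
      e2 (φ + bp - b) ≥ e2 φ - ε / 2) ∧
    (sSup {r : ℝ | ∃ ψ : Fin d → ℝ, mNorm (Matrix.diagonal lam) (ψ - bp) ≤ 1 ∧ r = e2 ψ} ≥
      sSup {r : ℝ | ∃ φ : Fin d → ℝ, mNorm (Matrix.diagonal lam) (φ - b) ≤ 1 ∧ r = e2 φ} - ε / 2) ∧
    ∀ ψ : Fin d → ℝ, mNorm (Matrix.diagonal lam) (ψ - bp) ≤ 1 →
      e2 ψ ≥ sSup {r : ℝ | ∃ ψ' : Fin d → ℝ,
        mNorm (Matrix.diagonal lam) (ψ' - bp) ≤ 1 ∧ r = e2 ψ'} - ε / 2 →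
      mNorm (Matrix.diagonal lam) ((ψ + b - bp) - b) ≤ 1 ∧
      e2 (ψ + b - bp) ≥ sSup {r : ℝ | ∃ φ' : Fin d → ℝ,
        mNorm (Matrix.diagonal lam) (φ' - b) ≤ 1 ∧ r = e2 φ'} - ε := by
  have hm : 0 ≤ ε / (2 * √(d : ℝ)) := by positivity
  have habs : ∀ i, |b i| ≤ |bp i| := fun i => by
    rw [hbp i, abs_mul, abs_of_nonneg (le_max_of_le_right hm)]
    split_ifs <;> simp
  have hdiff : e2 (bp - b) ≤ ε / 2 := e2_le_of_abs_le (by positivity) fun i => by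
    rw [div_div, Pi.sub_apply, hbp i]
    split_ifs with hb
    · rw [abs_of_nonneg hb]
      rcases max_cases (b i) (ε / (2 * √(d : ℝ))) with h | h <;> rw [h.1, abs_le] <;>
        constructor <;> linarith
    · rw [abs_of_neg (not_le.1 hb)]
      rcases max_cases (-b i) (ε / (2 * √(d : ℝ))) with h | h <;> rw [h.1, abs_le] <;>
        constructor <;> linarith
  have hsup := sSup_e2_ellipsoid_mono hlam habs
  refine ⟨fun φ hφ => ?_, by linarith, fun ψ hψ hmax => ?_⟩
  · rw [show φ + bp - b - bp = φ - b by abel, add_sub_assoc]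
    exact ⟨rfl, hφ, by linarith [e2_sub_le_e2_add φ (bp - b)]⟩
  · rw [show ψ + b - bp - b = ψ - bp by abel, show ψ + b - bp = ψ - (bp - b) by abel]
    exact ⟨hψ, by linarith [e2_sub_le_e2_sub ψ (bp - b)]⟩
end

section
/- Let λ_1 ≥ λ_2 ≥ … ≥ λ_d > 0 and b ∈ ℝ^d with bᵢ ≠ 0 for all i. Define g(μ) = Σ_{i=1}^d λᵢ bᵢ² / (μλᵢ − 1)² for μ > 1/λ_d. Then g is strictly decreasing on (1/λ_d, ∞), tends to +∞ as μ → (1/λ_d)⁺ and to 0 as μ → ∞, and the equation g(μ) = 1 has a unique solution μ* ∈ (1/λ_d, ∞). Moreover μ* ∈ [m, M] with m = λ_d^{−1}(λ_d^{1/2}|b_d| + 1) and M = λ_d^{−1}(√(Σ_{i=1}^d λᵢ bᵢ²) + 1). -/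
open Set Filter

section SecularFunction

variable {ι : Type*} {lam b : ι → ℝ} {k : ι}

lemma mul_sub_one_pos_of_mem_Ioi (hpos : ∀ i, 0 < lam i) (hk : ∀ i, lam k ≤ lam i) {μ : ℝ}
    (hμ : μ ∈ Ioi (1 / lam k)) (i : ι) : 0 < μ * lam i - 1 := by
  have h : 1 < μ * lam k := (div_lt_iff₀ (hpos k)).1 hμ
  have hμ0 : 0 < μ := (one_div_pos.2 (hpos k)).trans hμ
  have := mul_le_mul_of_nonneg_left (hk i) hμ0.le
  linarith

variable [Fintype ι]

/-- The secular function `μ ↦ ∑ᵢ λᵢ bᵢ² / (μ λᵢ - 1)²`. -/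
noncomputable def secularFun (lam b : ι → ℝ) (μ : ℝ) : ℝ :=
  ∑ i, lam i * b i ^ 2 / (μ * lam i - 1) ^ 2

lemma secularFun_strictAntiOn (hpos : ∀ i, 0 < lam i) (hk : ∀ i, lam k ≤ lam i)
    (hb : ∀ i, b i ≠ 0) : StrictAntiOn (secularFun lam b) (Ioi (1 / lam k)) := by
  intro x hx y hy hxy
  refine Finset.sum_lt_sum_of_nonempty ⟨k, Finset.mem_univ k⟩ fun i _ => ?_
  have hx0 := mul_sub_one_pos_of_mem_Ioi hpos hk hx i
  have hc : 0 < lam i * b i ^ 2 := mul_pos (hpos i) (by have := hb i; positivity)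
  have hlt := mul_lt_mul_of_pos_right hxy (hpos i)
  refine div_lt_div_of_pos_left hc (by positivity) ?_
  exact pow_lt_pow_left₀ (by linarith) hx0.le two_ne_zero

lemma secularFun_term_le (hpos : ∀ i, 0 < lam i) (k : ι) (μ : ℝ) :
    lam k * b k ^ 2 / (μ * lam k - 1) ^ 2 ≤ secularFun lam b μ :=
  Finset.single_le_sum (f := fun i => lam i * b i ^ 2 / (μ * lam i - 1) ^ 2)
    (fun i _ => by have := hpos i; positivity) (Finset.mem_univ k)

lemma secularFun_le (hpos : ∀ i, 0 < lam i) (hk : ∀ i, lam k ≤ lam i) {μ : ℝ}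
    (hμ : μ ∈ Ioi (1 / lam k)) :
    secularFun lam b μ ≤ (∑ i, lam i * b i ^ 2) / (μ * lam k - 1) ^ 2 := by
  rw [Finset.sum_div]
  refine Finset.sum_le_sum fun i _ => ?_
  have h0 := mul_sub_one_pos_of_mem_Ioi hpos hk hμ k
  have hμ0 : 0 < μ := (one_div_pos.2 (hpos k)).trans hμ
  have := mul_le_mul_of_nonneg_left (hk i) hμ0.le
  have := hpos i
  refine div_le_div_of_nonneg_left (by positivity) (by positivity) ?_
  exact pow_le_pow_left₀ h0.le (by linarith) 2

lemma secularFun_tendsto_atTop (hpos : ∀ i, 0 < lam i) (hk : ∀ i, lam k ≤ lam i)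
    (hb : ∀ i, b i ≠ 0) :
    Tendsto (secularFun lam b) (nhdsWithin (1 / lam k) (Ioi (1 / lam k))) atTop := by
  refine tendsto_atTop_mono (secularFun_term_le hpos k) ?_
  have hc : 0 < lam k * b k ^ 2 := mul_pos (hpos k) (by have := hb k; positivity)
  simp only [div_eq_mul_inv (lam k * b k ^ 2)]
  refine Tendsto.const_mul_atTop hc (tendsto_inv_nhdsGT_zero.comp ?_)
  refine tendsto_nhdsWithin_iff.2 ⟨?_, ?_⟩
  · have hcont : Continuous fun μ : ℝ => (μ * lam k - 1) ^ 2 := by fun_prop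
    have := (hcont.tendsto (1 / lam k)).mono_left
      (nhdsWithin_le_nhds (s := Ioi (1 / lam k)))
    simpa [(hpos k).ne'] using this
  · filter_upwards [self_mem_nhdsWithin] with μ hμ
    exact pow_pos (mul_sub_one_pos_of_mem_Ioi hpos hk hμ k) 2

lemma secularFun_tendsto_zero (hpos : ∀ i, 0 < lam i) :
    Tendsto (secularFun lam b) atTop (nhds 0) := by
  have : Tendsto (secularFun lam b) atTop (nhds (∑ _i : ι, (0 : ℝ))) := by
    refine tendsto_finsetSum _ fun i _ => ?_
    refine Tendsto.const_div_atTop ?_ _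
    refine (tendsto_pow_atTop two_ne_zero).comp ?_
    exact tendsto_atTop_add_const_right _ _ (tendsto_id.atTop_mul_const (hpos i))
  simpa using this

lemma secularFun_continuousOn (hpos : ∀ i, 0 < lam i) (hk : ∀ i, lam k ≤ lam i) :
    ContinuousOn (secularFun lam b) (Ioi (1 / lam k)) := by
  refine continuousOn_finsetSum _ fun i _ => ?_
  refine ContinuousOn.div (by fun_prop) (by fun_prop) fun μ hμ => ?_
  exact (pow_pos (mul_sub_one_pos_of_mem_Ioi hpos hk hμ i) 2).ne'

lemma secularFun_existsUnique (hpos : ∀ i, 0 < lam i) (hk : ∀ i, lam k ≤ lam i)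
    (hb : ∀ i, b i ≠ 0) :
    ∃! μ : ℝ, μ ∈ Ioi (1 / lam k) ∧ secularFun lam b μ = 1 := by
  obtain ⟨x, hx1, hx⟩ := (((secularFun_tendsto_atTop hpos hk hb).eventually_ge_atTop 1).and
    self_mem_nhdsWithin).exists
  obtain ⟨y, hy1, hy⟩ := (((secularFun_tendsto_zero (b := b) hpos).eventually_le_const
    one_pos).and (eventually_gt_atTop (1 / lam k))).exists
  obtain ⟨μ, hμ, h1⟩ := isPreconnected_Ioi.intermediate_value (mem_Ioi.2 hy) hx
    (secularFun_continuousOn (b := b) hpos hk) ⟨hy1, hx1⟩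
  exact ⟨μ, ⟨hμ, h1⟩, fun ν hν =>
    (secularFun_strictAntiOn hpos hk hb).injOn hν.1 hμ (hν.2.trans h1.symm)⟩

lemma mem_Icc_of_secularFun_eq_one (hpos : ∀ i, 0 < lam i) (hk : ∀ i, lam k ≤ lam i)
    {μ : ℝ} (hμ : μ ∈ Ioi (1 / lam k)) (h1 : secularFun lam b μ = 1) :
    μ ∈ Icc ((lam k)⁻¹ * (Real.sqrt (lam k) * |b k| + 1))
      ((lam k)⁻¹ * (Real.sqrt (∑ i, lam i * b i ^ 2) + 1)) := by
  have h0 := mul_sub_one_pos_of_mem_Ioi hpos hk hμ k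
  have hsq : 0 < (μ * lam k - 1) ^ 2 := by positivity
  constructor
  · have h := (secularFun_term_le (b := b) hpos k μ).trans_eq h1
    rw [div_le_one hsq] at h
    have h2 : Real.sqrt (lam k) * |b k| ≤ μ * lam k - 1 := by
      rw [← Real.sqrt_sq_eq_abs, ← Real.sqrt_mul (hpos k).le]
      exact Real.sqrt_le_iff.2 ⟨h0.le, h⟩
    rw [inv_mul_le_iff₀ (hpos k)]
    linarith
  · have h := h1.symm.trans_le (secularFun_le (b := b) hpos hk hμ)
    rw [one_le_div hsq] at h
    have h2 := Real.le_sqrt_of_sq_le h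
    rw [le_inv_mul_iff₀ (hpos k)]
    linarith

end SecularFunction

/-- for `λ₁ ≥ … ≥ λ_d > 0` (here indexed by `Fin (n+1)` so that
`λ_d = lam (Fin.last n)` is the smallest) and `b` with all entries nonzero, the
function `g(μ) = Σᵢ λᵢbᵢ²/(μλᵢ - 1)²` is strictly decreasing on `(1/λ_d, ∞)`,
tends to `+∞` as `μ → (1/λ_d)⁺` and to `0` as `μ → ∞`, the equation `g(μ) = 1`
has a unique solution `μ*` in `(1/λ_d, ∞)`, and any such solution lies in
`[m, M]` with `m = λ_d⁻¹(λ_d^{1/2}|b_d| + 1)` and `M = λ_d⁻¹(√(Σᵢ λᵢbᵢ²) + 1)`. -/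
theorem stmt8 {n : ℕ} (lam : Fin (n + 1) → ℝ) (hpos : ∀ i, 0 < lam i)
    (hsort : ∀ i j : Fin (n + 1), i ≤ j → lam j ≤ lam i)
    (b : Fin (n + 1) → ℝ) (hb : ∀ i, b i ≠ 0) :
    StrictAntiOn (fun μ : ℝ => ∑ i, lam i * b i ^ 2 / (μ * lam i - 1) ^ 2)
      (Set.Ioi (1 / lam (Fin.last n))) ∧
    Tendsto (fun μ : ℝ => ∑ i, lam i * b i ^ 2 / (μ * lam i - 1) ^ 2)
      (nhdsWithin (1 / lam (Fin.last n)) (Set.Ioi (1 / lam (Fin.last n)))) atTop ∧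
    Tendsto (fun μ : ℝ => ∑ i, lam i * b i ^ 2 / (μ * lam i - 1) ^ 2)
      atTop (nhds 0) ∧
    (∃! μ : ℝ, μ ∈ Set.Ioi (1 / lam (Fin.last n)) ∧
      ∑ i, lam i * b i ^ 2 / (μ * lam i - 1) ^ 2 = 1) ∧
    ∀ μ ∈ Set.Ioi (1 / lam (Fin.last n)),
      (∑ i, lam i * b i ^ 2 / (μ * lam i - 1) ^ 2) = 1 →
      μ ∈ Set.Icc
        ((lam (Fin.last n))⁻¹ * (Real.sqrt (lam (Fin.last n)) * |b (Fin.last n)| + 1))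
        ((lam (Fin.last n))⁻¹ * (Real.sqrt (∑ i, lam i * b i ^ 2) + 1)) := by
  have hk : ∀ i, lam (Fin.last n) ≤ lam i := fun i => hsort i _ (Fin.le_last i)
  exact ⟨secularFun_strictAntiOn hpos hk hb, secularFun_tendsto_atTop hpos hk hb,
    secularFun_tendsto_zero hpos, secularFun_existsUnique hpos hk hb,
    fun _ hμ h1 => mem_Icc_of_secularFun_eq_one hpos hk hμ h1⟩
end

section
/- Let λ_1 ≥ λ_2 ≥ … ≥ λ_d > 0 and b ∈ ℝ^d with bᵢ ≠ 0 for all i, and set m = λ_d^{−1}(λ_d^{1/2}|b_d| + 1). Then for every μ ≥ m, Σ_{i=1}^d (λᵢ bᵢ)² / (μλᵢ − 1)⁴ ≤ (λ_d² b_d⁴)^{−1} · Σ_{i=1}^d λᵢ² bᵢ². -/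
open Set

/-- for `λ₁ ≥ … ≥ λ_d > 0` (indexed by `Fin (n+1)`, so that
`λ_d = lam (Fin.last n)` is the smallest), `b` with all entries nonzero and
`m = λ_d⁻¹(λ_d^{1/2}|b_d| + 1)`, every `μ ≥ m` satisfies
`Σᵢ (λᵢbᵢ)²/(μλᵢ - 1)⁴ ≤ (λ_d²b_d⁴)⁻¹ · Σᵢ λᵢ²bᵢ²`. -/
theorem stmt9 {n : ℕ} (lam : Fin (n + 1) → ℝ) (hpos : ∀ i, 0 < lam i)
    (hsort : ∀ i j : Fin (n + 1), i ≤ j → lam j ≤ lam i)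
    (b : Fin (n + 1) → ℝ) (hb : ∀ i, b i ≠ 0) (μ : ℝ)
    (hμ : (lam (Fin.last n))⁻¹ * (Real.sqrt (lam (Fin.last n)) * |b (Fin.last n)| + 1) ≤ μ) :
    ∑ i, (lam i * b i) ^ 2 / (μ * lam i - 1) ^ 4 ≤
      (lam (Fin.last n) ^ 2 * b (Fin.last n) ^ 4)⁻¹ * ∑ i, lam i ^ 2 * b i ^ 2 := by
  set l := lam (Fin.last n)
  set c := b (Fin.last n)
  have hl : 0 < l := hpos _
  have hc : 0 < |c| := abs_pos.mpr (hb _)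
  have hs : 0 < √l * |c| := mul_pos (Real.sqrt_pos.mpr hl) hc
  have hμl : √l * |c| + 1 ≤ μ * l := by
    rwa [inv_mul_le_iff₀ hl, mul_comm l] at hμ
  have hμ0 : 0 < μ := pos_of_mul_pos_left (by linarith) hl.le
  have hpow : (√l * |c|) ^ 4 = l ^ 2 * c ^ 4 := by
    rw [mul_pow, (by decide : Even 4).pow_abs, show (√l) ^ 4 = (√l ^ 2) ^ 2 by ring,
      Real.sq_sqrt hl.le]
  rw [Finset.mul_sum, ← hpow]
  refine Finset.sum_le_sum fun i _ => ?_
  have hi : μ * l ≤ μ * lam i :=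
    mul_le_mul_of_nonneg_left (hsort i _ (Fin.le_last i)) hμ0.le
  rw [← mul_pow, inv_mul_eq_div]
  gcongr
  linarith
end

section
/- Let p ≥ 2, λ_1, …, λ_d > 0, and c ∈ ℝ^d. Then the function H(y) = − Σ_{i=1}^d yᵢ^{1/p}·|cᵢ| − √(Σ_{i=1}^d λᵢ^{−1} yᵢ^{2/p}) is convex on the nonnegative orthant {y ∈ ℝ^d : yᵢ ≥ 0 for all i}. -/
/-- A nonnegatively weighted sum of coordinatewise powers with exponent in `[0, 1]` is concave on
the nonnegative orthant. -/
theorem concaveOn_sum_rpow_mul {ι : Type*} [Fintype ι] {s : ℝ} (hs₀ : 0 ≤ s) (hs₁ : s ≤ 1)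
    {w : ι → ℝ} (hw : ∀ i, 0 ≤ w i) :
    ConcaveOn ℝ {y : ι → ℝ | ∀ i, 0 ≤ y i} (fun y => ∑ i, y i ^ s * w i) := by
  refine ⟨convex_Ici (0 : ι → ℝ), fun x hx y hy a b ha hb hab => ?_⟩
  simp only [smul_eq_mul, Finset.mul_sum, ← Finset.sum_add_distrib, Pi.add_apply, Pi.smul_apply]
  refine Finset.sum_le_sum fun i _ => ?_
  have h := (Real.concaveOn_rpow hs₀ hs₁).2 (hx i) (hy i) ha hb hab
  simp only [smul_eq_mul] at h
  calc a * (x i ^ s * w i) + b * (y i ^ s * w i) = (a * x i ^ s + b * y i ^ s) * w i := by ring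
    _ ≤ (a * x i + b * y i) ^ s * w i := mul_le_mul_of_nonneg_right h (hw i)

/-- The square root of a nonnegative concave function is concave. -/
theorem ConcaveOn.sqrt {E : Type*} [AddCommMonoid E] [Module ℝ E] {t : Set E} {f : E → ℝ}
    (hf : ConcaveOn ℝ t f) (hf₀ : ∀ x ∈ t, 0 ≤ f x) :
    ConcaveOn ℝ t (fun x => √(f x)) :=
  ⟨hf.1, fun _ hx _ hy _ _ ha hb hab =>
    (Real.strictConcaveOn_sqrt.concaveOn.2 (hf₀ _ hx) (hf₀ _ hy) ha hb hab).trans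
      (Real.sqrt_le_sqrt (hf.2 hx hy ha hb hab))⟩

/-- for `p ≥ 2`, `λᵢ > 0` and `c ∈ ℝ^d`, the function
`H(y) = -Σᵢ yᵢ^{1/p}|cᵢ| - √(Σᵢ λᵢ⁻¹ yᵢ^{2/p})` is convex on the nonnegative
orthant. -/
theorem stmt14 {d : ℕ} (p : ℝ) (hp : 2 ≤ p) (lam : Fin d → ℝ) (hpos : ∀ i, 0 < lam i)
    (c : Fin d → ℝ) :
    ConvexOn ℝ {y : Fin d → ℝ | ∀ i, 0 ≤ y i}
      (fun y => -∑ i, y i ^ (1 / p) * |c i| -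
        Real.sqrt (∑ i, (lam i)⁻¹ * y i ^ (2 / p))) := by
  have hp₀ : 0 < p := by linarith
  have hw : ∀ i, 0 ≤ (lam i)⁻¹ := fun i => (inv_pos.2 (hpos i)).le
  have h₁ := concaveOn_sum_rpow_mul (s := 1 / p) (by positivity)
    ((div_le_one hp₀).2 (by linarith)) (fun i => abs_nonneg (c i))
  have h₂ := (concaveOn_sum_rpow_mul (s := 2 / p) (by positivity)
    ((div_le_one hp₀).2 hp) hw).sqrt
    fun y hy => Finset.sum_nonneg fun i _ => mul_nonneg (Real.rpow_nonneg (hy i) _) (hw i)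
  simp only [mul_comm _ (lam _)⁻¹] at h₂
  exact h₁.neg.sub h₂
end

section
/- Let λ_1 ≥ … ≥ λ_d > 0 and b ∈ ℝ^d, and let y* minimize F(y) = − Σ_{i=1}^d |bᵢ|·√(yᵢ) − √(Σ_{i=1}^d λᵢ^{−1} yᵢ) over the simplex Δ_{d−1} = {y ∈ ℝ^d : yᵢ ≥ 0, Σᵢ yᵢ = 1}. Then Σᵢ y*ᵢ = 1 and, for every i ∈ [d], y*ᵢ ≥ Bᵢ where Bᵢ = bᵢ² / (‖b‖_2 + λ_d^{−1/2})². -/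
open Set

/-- The simplex `Δ_{d-1} = {y : yᵢ ≥ 0, Σᵢ yᵢ = 1}`. -/
def stdSimplex' (d : ℕ) : Set (Fin d → ℝ) :=
  {y | (∀ i, 0 ≤ y i) ∧ ∑ i, y i = 1}

/-- The objective `F(y) = -Σᵢ |bᵢ|√(yᵢ) - √(Σᵢ λᵢ⁻¹ yᵢ)` of problem `P_C`. -/
noncomputable def Fobj {d : ℕ} (lam b : Fin d → ℝ) (y : Fin d → ℝ) : ℝ :=
  -∑ i, |b i| * Real.sqrt (y i) - Real.sqrt (∑ i, (lam i)⁻¹ * y i)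

/-- Moving from a minimizer towards the vertex `eᵢ` along `p² ys + (1 - p²) eᵢ` does not
decrease `F`; after rationalizing, this bounds `|bᵢ|` for each `p ∈ (0, 1)`. -/
lemma abs_mul_one_add_le_of_minimizer {d : ℕ} {lam b ys : Fin d → ℝ} (hpos : ∀ i, 0 < lam i)
    (hmem : ys ∈ stdSimplex' d) (hmin : ∀ y ∈ stdSimplex' d, Fobj lam b ys ≤ Fobj lam b y)
    (i : Fin d) {p : ℝ} (hp₀ : 0 < p) (hp₁ : p < 1) :
    |b i| * (1 + p) ≤
      -Fobj lam b ys * (√(p ^ 2 * ys i + (1 - p ^ 2)) + p * √(ys i)) := by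
  obtain ⟨hnonneg, hsum⟩ := hmem
  have hp₂ : 0 < 1 - p ^ 2 := by nlinarith
  have hmove := hmin (fun j => p ^ 2 * ys j + if j = i then 1 - p ^ 2 else 0)
    ⟨fun j => by have := hnonneg j; dsimp only; split_ifs <;> positivity,
      by simp [Finset.sum_add_distrib, ← Finset.mul_sum, hsum]⟩
  have hsqrt (x : ℝ) : √(p ^ 2 * x) = p * √x := by
    rw [Real.sqrt_mul (sq_nonneg p), Real.sqrt_sq hp₀.le]
  set q := √(p ^ 2 * ys i + (1 - p ^ 2)) with hq
  have hfirst : ∑ j, |b j| * √(p ^ 2 * ys j + if j = i then 1 - p ^ 2 else 0) =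
      p * ∑ j, |b j| * √(ys j) + |b i| * (q - p * √(ys i)) := by
    have hterm (j : Fin d) : |b j| * √(p ^ 2 * ys j + if j = i then 1 - p ^ 2 else 0) =
        p * (|b j| * √(ys j)) + if j = i then |b i| * (q - p * √(ys i)) else 0 := by
      split_ifs with h
      · subst h
        rw [← hq]
        ring
      · rw [add_zero, hsqrt]
        ring
    simp [hterm, Finset.sum_add_distrib, Finset.mul_sum]
  have hsecond : p * √(∑ j, (lam j)⁻¹ * ys j) ≤
      √(∑ j, (lam j)⁻¹ * (p ^ 2 * ys j + if j = i then 1 - p ^ 2 else 0)) := by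
    rw [← hsqrt, Finset.mul_sum]
    refine Real.sqrt_le_sqrt (Finset.sum_le_sum fun j _ => ?_)
    have hinv := inv_pos.2 (hpos j)
    have hextra : 0 ≤ (lam j)⁻¹ * if j = i then 1 - p ^ 2 else 0 := by
      split_ifs <;> positivity
    linarith
  have hgap : |b i| * (q - p * √(ys i)) ≤ (1 - p) * -Fobj lam b ys := by
    simp only [Fobj, hfirst] at hmove ⊢
    linarith
  have hyi := hnonneg i
  have hq_sq : q ^ 2 = p ^ 2 * ys i + (1 - p ^ 2) := Real.sq_sqrt (by positivity)
  have hy_sq : √(ys i) ^ 2 = ys i := Real.sq_sqrt hyi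
  have hfactor : 0 ≤ q + p * √(ys i) := by positivity
  have hmul := mul_le_mul_of_nonneg_right hgap hfactor
  have hrat : |b i| * (q - p * √(ys i)) * (q + p * √(ys i)) = (1 - p) * (|b i| * (1 + p)) := by
    linear_combination |b i| * hq_sq - |b i| * p ^ 2 * hy_sq
  rw [hrat, mul_assoc] at hmul
  exact le_of_mul_le_mul_left hmul (by linarith)

/-- First-order condition at a minimizer of `F` over the simplex. -/
lemma abs_le_neg_Fobj_mul_sqrt_of_minimizer {d : ℕ} {lam b ys : Fin d → ℝ}
    (hpos : ∀ i, 0 < lam i) (hmem : ys ∈ stdSimplex' d)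
    (hmin : ∀ y ∈ stdSimplex' d, Fobj lam b ys ≤ Fobj lam b y) (i : Fin d) :
    |b i| ≤ -Fobj lam b ys * √(ys i) := by
  have hleft : Continuous fun p : ℝ => |b i| * (1 + p) := by fun_prop
  have hright : Continuous fun p : ℝ =>
      -Fobj lam b ys * (√(p ^ 2 * ys i + (1 - p ^ 2)) + p * √(ys i)) := by fun_prop
  have hlim := le_of_tendsto_of_tendsto
    ((hleft.tendsto 1).mono_left (nhdsWithin_le_nhds (s := Iio 1)))
    ((hright.tendsto 1).mono_left nhdsWithin_le_nhds)
    (by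
      filter_upwards [Ioo_mem_nhdsLT (show (0 : ℝ) < 1 by norm_num)] with p hp
      exact abs_mul_one_add_le_of_minimizer hpos hmem hmin i hp.1 hp.2)
  norm_num at hlim
  linarith

/-- Cauchy–Schwarz for the first term of `F`, and a bound of the weighted mean by the largest
weight for the second. -/
lemma neg_Fobj_le {d : ℕ} {lam b ys : Fin d → ℝ} {m : ℝ} (hm : 0 < m) (hlam : ∀ i, m ≤ lam i)
    (hmem : ys ∈ stdSimplex' d) : -Fobj lam b ys ≤ e2 b + (√m)⁻¹ := by
  obtain ⟨hnonneg, hsum⟩ := hmem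
  have hcs : ∑ j, |b j| * √(ys j) ≤ e2 b := by
    simpa [e2, Real.sq_sqrt (hnonneg _), hsum] using
      Real.sum_mul_le_sqrt_mul_sqrt Finset.univ (fun j => |b j|) (fun j => √(ys j))
  have hmean : √(∑ j, (lam j)⁻¹ * ys j) ≤ (√m)⁻¹ := by
    rw [← Real.sqrt_inv]
    refine Real.sqrt_le_sqrt ?_
    calc ∑ j, (lam j)⁻¹ * ys j ≤ ∑ j, m⁻¹ * ys j :=
          Finset.sum_le_sum fun j _ =>
            mul_le_mul_of_nonneg_right (inv_anti₀ hm (hlam j)) (hnonneg j)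
      _ = m⁻¹ := by rw [← Finset.mul_sum, hsum, mul_one]
  simp only [Fobj]
  linarith

/-- for `λ₁ ≥ … ≥ λ_d > 0` (indexed by `Fin (n+1)`, so that
`λ_d = lam (Fin.last n)` is the smallest), if `y*` minimizes `F` over the
simplex then `Σᵢ y*ᵢ = 1` and `y*ᵢ ≥ Bᵢ = bᵢ²/(‖b‖₂ + λ_d^{-1/2})²` for all `i`. -/
theorem stmt16 {n : ℕ} (lam : Fin (n + 1) → ℝ) (hpos : ∀ i, 0 < lam i)
    (hsort : ∀ i j : Fin (n + 1), i ≤ j → lam j ≤ lam i)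
    (b : Fin (n + 1) → ℝ) (ys : Fin (n + 1) → ℝ)
    (hmem : ys ∈ stdSimplex' (n + 1))
    (hmin : ∀ y ∈ stdSimplex' (n + 1), Fobj lam b ys ≤ Fobj lam b y) :
    (∑ i, ys i = 1) ∧
    ∀ i, b i ^ 2 / (e2 b + (Real.sqrt (lam (Fin.last n)))⁻¹) ^ 2 ≤ ys i := by
  refine ⟨hmem.2, fun i => ?_⟩
  have hlast := hpos (Fin.last n)
  have hC : 0 < e2 b + (√(lam (Fin.last n)))⁻¹ :=
    add_pos_of_nonneg_of_pos (Real.sqrt_nonneg _) (inv_pos.2 (Real.sqrt_pos.2 hlast))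
  have hb : |b i| ≤ (e2 b + (√(lam (Fin.last n)))⁻¹) * √(ys i) :=
    (abs_le_neg_Fobj_mul_sqrt_of_minimizer hpos hmem hmin i).trans
      (mul_le_mul_of_nonneg_right
        (neg_Fobj_le hlast (fun j => hsort j _ (Fin.le_last j)) hmem) (Real.sqrt_nonneg _))
  rw [div_le_iff₀ (pow_pos hC 2), ← sq_abs]
  calc |b i| ^ 2 ≤ ((e2 b + (√(lam (Fin.last n)))⁻¹) * √(ys i)) ^ 2 :=
        pow_le_pow_left₀ (abs_nonneg _) hb 2
    _ = ys i * (e2 b + (√(lam (Fin.last n)))⁻¹) ^ 2 := by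
        rw [mul_pow, Real.sq_sqrt (hmem.1 i), mul_comm]
end
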